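/- Let K ⊂ ℝⁿ be an isotropic convex body, and let (C_m)_{m≥1} be Borel subsets of ℝⁿ with C_m ∩ int(K) = ∅, |C_m| > 0, |C_m| → 0, such that K_m := K ∪ C_m is a convex body for every m. Let g_m be the centroid of K_m and M_{K_m}² the isotropy parameter of K_m, i.e. M_{K_m}^{2n} = (1/n!) ∫_{K_m − g_m} ⋯ ∫_{K_m − g_m} (det(X₁,…,Xₙ))² dX₁ ⋯ dXₙ. Then there exist C > 0 and m₀ such that for all m ≥ m₀: | M_{K_m}^{2n} − (1/n!) ∫_{K_m} ⋯ ∫_{K_m} (det(X₁,…,Xₙ))² dX₁ ⋯ dXₙ | ≤ C |K_m \ K|². -/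

import Mathlib

open MeasureTheory Metric Set Filter
open scoped InnerProductSpace Topology

noncomputable section

/-- A convex body in ℝⁿ: a compact convex set with nonempty interior. -/
def IsConvexBody {n : ℕ} (K : Set (EuclideanSpace ℝ (Fin n))) : Prop :=
  IsCompact K ∧ Convex ℝ K ∧ (interior K).Nonempty

/-- The centroid of a set. -/
def centroid {n : ℕ} (K : Set (EuclideanSpace ℝ (Fin n))) : EuclideanSpace ℝ (Fin n) :=
  ((volume K).toReal)⁻¹ • ∫ x in K, x

/-- `(1/n!) ∫_{A}⋯∫_{A} det(X₁ − g, …, Xₙ − g)² dX₁ ⋯ dXₙ`. -/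
def detInt {n : ℕ} (A : Set (EuclideanSpace ℝ (Fin n))) (g : EuclideanSpace ℝ (Fin n)) : ℝ :=
  ((n.factorial : ℝ))⁻¹ *
    ∫ X in Set.univ.pi (fun _ : Fin n => A),
      (Matrix.det (Matrix.of fun i j : Fin n => X j i - g i)) ^ 2
      ∂(Measure.pi fun _ : Fin n => volume)

/-- `M_K^{2n}`, the 2n-th power of the isotropy parameter of a convex body. -/
def Mpow2n {n : ℕ} (K : Set (EuclideanSpace ℝ (Fin n))) : ℝ := detInt K (centroid K)

/-- The isotropy constant `L_K = M_K / |K|^{(n+2)/(2n)}` of a convex body. -/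
def isoL (n : ℕ) (K : Set (EuclideanSpace ℝ (Fin n))) : ℝ :=
  (Mpow2n K) ^ ((2 * (n : ℝ)))⁻¹ / (volume K).toReal ^ (((n : ℝ) + 2) / (2 * n))

/-- `K` is isotropic with isotropy parameter `M`. -/
def IsIsotropic {n : ℕ} (K : Set (EuclideanSpace ℝ (Fin n))) (M : ℝ) : Prop :=
  0 < M ∧ (∫ x in K, x) = 0 ∧
    ∀ y : EuclideanSpace ℝ (Fin n), (∫ x in K, (⟪x, y⟫_ℝ) ^ 2) = M ^ 2 * ‖y‖ ^ 2

/-- `(N, q)` witnesses positive generalized Gauss curvature of `K` at `X₀`. -/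
def CurvWitness {n : ℕ} (K : Set (EuclideanSpace ℝ (Fin n))) (X₀ N : EuclideanSpace ℝ (Fin n))
    (q : QuadraticForm ℝ (EuclideanSpace ℝ (Fin n))) : Prop :=
  ‖N‖ = 1 ∧ (∀ x ∈ K, 0 ≤ ⟪x - X₀, N⟫_ℝ) ∧
  (∀ Y : EuclideanSpace ℝ (Fin n), ⟪Y, N⟫_ℝ = 0 → Y ≠ 0 → 0 < q Y) ∧
  ∀ ε > (0 : ℝ), ∃ a > (0 : ℝ), ∀ (Y : EuclideanSpace ℝ (Fin n)) (y : ℝ), ⟪Y, N⟫_ℝ = 0 →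
    X₀ + Y + y • N ∈ frontier K ∩ Metric.ball X₀ a →
    (1 - ε) * q Y ≤ y ∧ y ≤ (1 + ε) * q Y

/-- `K` has positive generalized Gauss curvature at `X₀`. -/
def HasPosGenCurvature {n : ℕ} (K : Set (EuclideanSpace ℝ (Fin n)))
    (X₀ : EuclideanSpace ℝ (Fin n)) : Prop :=
  ∃ N q, CurvWitness K X₀ N q

/-- `K` is a local maximizer for the isotropy constant (Hausdorff distance). -/
def IsLocalMaxIso {n : ℕ} (K : Set (EuclideanSpace ℝ (Fin n))) : Prop :=
  ∃ ε > (0 : ℝ), ∀ K' : Set (EuclideanSpace ℝ (Fin n)), IsConvexBody K' →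
    hausdorffDist K' K < ε → isoL n K' ≤ isoL n K

/-- `K` is a local minimizer for the isotropy constant (Hausdorff distance). -/
def IsLocalMinIso {n : ℕ} (K : Set (EuclideanSpace ℝ (Fin n))) : Prop :=
  ∃ ε > (0 : ℝ), ∀ K' : Set (EuclideanSpace ℝ (Fin n)), IsConvexBody K' →
    hausdorffDist K' K < ε → isoL n K ≤ isoL n K'

/-- `X₀` is a point of local strict convexity of `∂K`. -/
def IsLocalStrictConvexPoint {n : ℕ} (K : Set (EuclideanSpace ℝ (Fin n)))
    (X₀ : EuclideanSpace ℝ (Fin n)) : Prop :=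
  X₀ ∈ frontier K ∧
    ¬ ∃ A B : EuclideanSpace ℝ (Fin n), A ≠ B ∧ segment ℝ A B ⊆ frontier K ∧ X₀ ∈ segment ℝ A B


/-- Andréief's identity for a squared determinant: the integral over independent copies of `x` of
the squared determinant with columns `f · (x j)` is `n!` times the determinant of the Gram matrix. -/
theorem integral_det_sq_eq_factorial_mul_det {α : Type*} [MeasurableSpace α] {n : ℕ}
    (μ : Measure α) [SigmaFinite μ] (f : Fin n → α → ℝ)
    (hf : ∀ i k, Integrable (fun x => f i x * f k x) μ) :
    ∫ X : Fin n → α, (Matrix.det (Matrix.of fun i j : Fin n => f i (X j))) ^ 2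
        ∂(Measure.pi fun _ : Fin n => μ)
      = n.factorial * Matrix.det (Matrix.of fun i k : Fin n => ∫ x, f i x * f k x ∂μ) := by
  have hexp : ∀ X : Fin n → α, (Matrix.det (Matrix.of fun i j : Fin n => f i (X j))) ^ 2
      = ∑ σ : Equiv.Perm (Fin n), ∑ τ : Equiv.Perm (Fin n),
          ((Equiv.Perm.sign σ : ℤ) : ℝ) * ((Equiv.Perm.sign τ : ℤ) : ℝ) *
            ∏ j, f (σ j) (X j) * f (τ j) (X j) := by
    intro X
    rw [sq, Matrix.det_apply', Finset.sum_mul_sum]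
    refine Finset.sum_congr rfl fun σ _ => Finset.sum_congr rfl fun τ _ => ?_
    rw [Finset.prod_mul_distrib]
    simp only [Matrix.of_apply]
    ring
  have hint : ∀ σ τ : Equiv.Perm (Fin n), Integrable (fun X : Fin n → α =>
      ((Equiv.Perm.sign σ : ℤ) : ℝ) * ((Equiv.Perm.sign τ : ℤ) : ℝ) *
        ∏ j, f (σ j) (X j) * f (τ j) (X j)) (Measure.pi fun _ : Fin n => μ) := fun σ τ =>
    (Integrable.fintype_prod (f := fun j x => f (σ j) x * f (τ j) x)
      fun j => hf (σ j) (τ j)).const_mul _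
  simp_rw [hexp]
  rw [integral_finsetSum _ fun σ _ => integrable_finsetSum _ fun τ _ => hint σ τ]
  simp_rw [integral_finsetSum _ fun τ _ => hint _ τ, integral_const_mul]
  have hrow : ∀ σ : Equiv.Perm (Fin n), ∑ τ : Equiv.Perm (Fin n),
      ((Equiv.Perm.sign σ : ℤ) : ℝ) * ((Equiv.Perm.sign τ : ℤ) : ℝ) *
        ∫ X : Fin n → α, ∏ j, f (σ j) (X j) * f (τ j) (X j) ∂(Measure.pi fun _ : Fin n => μ)
      = Matrix.det (Matrix.of fun i k : Fin n => ∫ x, f i x * f k x ∂μ) := by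
    intro σ
    rw [← Matrix.det_transpose, Matrix.det_apply']
    refine Fintype.sum_equiv (Equiv.mulRight σ⁻¹) _ _ fun τ => ?_
    rw [integral_fintype_prod_eq_prod (f := fun j x => f (σ j) x * f (τ j) x)]
    congr 1
    · simp [mul_comm]
    · refine Fintype.prod_equiv σ _ _ fun j => ?_
      simp
  rw [Finset.sum_congr rfl fun σ _ => hrow σ]
  simp [Fintype.card_perm]

/-- The matrix of second moments of `A` about the point `g`. -/
def secondMoment {n : ℕ} (A : Set (EuclideanSpace ℝ (Fin n))) (g : EuclideanSpace ℝ (Fin n)) :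
    Fin n → Fin n → ℝ :=
  fun i k => ∫ x in A, (x i - g i) * (x k - g k)

theorem detInt_eq_det_secondMoment {n : ℕ} {A : Set (EuclideanSpace ℝ (Fin n))} (hA : IsCompact A)
    (g : EuclideanSpace ℝ (Fin n)) :
    detInt A g = Matrix.det (Matrix.of (secondMoment A g)) := by
  rw [detInt, Measure.restrict_pi_pi,
    integral_det_sq_eq_factorial_mul_det (volume.restrict A) (fun i x => x i - g i)
      fun i k => ContinuousOn.integrableOn_compact hA (by fun_prop), ← mul_assoc,
    inv_mul_cancel₀ (by positivity), one_mul]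
  rfl

theorem setIntegral_apply {n : ℕ} {A : Set (EuclideanSpace ℝ (Fin n))} (hA : IsCompact A)
    (i : Fin n) : ∫ x in A, x i = (∫ x in A, x) i :=
  (EuclideanSpace.proj (𝕜 := ℝ) i).integral_comp_comm
    (ContinuousOn.integrableOn_compact hA (continuousOn_id' A))

theorem secondMoment_centroid {n : ℕ} {A : Set (EuclideanSpace ℝ (Fin n))} (hA : IsCompact A)
    (hV : (volume A).toReal ≠ 0) (i k : Fin n) :
    secondMoment A (centroid A) i k = secondMoment A 0 i k
      - ((volume A).toReal)⁻¹ * ((∫ x in A, x) i * (∫ x in A, x) k) := by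
  have hint : ∀ f : EuclideanSpace ℝ (Fin n) → ℝ, Continuous f → IntegrableOn f A volume :=
    fun f hf => hf.continuousOn.integrableOn_compact hA
  set g := centroid A with hg
  have hgi : ∀ j, g j = ((volume A).toReal)⁻¹ * (∫ x in A, x) j := fun j => by
    simp [hg, centroid]
  have hexp : ∀ x : EuclideanSpace ℝ (Fin n), (x i - g i) * (x k - g k)
      = x i * x k - g k * x i - g i * x k + g i * g k := fun x => by ring
  have hconst : ∫ _ in A, g i * g k = (volume A).toReal * (g i * g k) := by
    simp [Measure.real]
  simp only [secondMoment, hexp]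
  rw [integral_add (hint _ (by fun_prop)) (hint _ (by fun_prop)),
    integral_sub (hint _ (by fun_prop)) (hint _ (by fun_prop)),
    integral_sub (hint _ (by fun_prop)) (hint _ (by fun_prop)),
    integral_const_mul, integral_const_mul, setIntegral_apply hA, setIntegral_apply hA, hconst,
    hgi, hgi]
  simp only [PiLp.zero_apply, sub_zero]
  field_simp
  ring

/-- A convex superset of a bounded body that adds little volume to it stays in a fixed ball. -/
theorem Convex.subset_closedBall_of_volume_diff_lt {E : Type*} [NormedAddCommGroup E]
    [NormedSpace ℝ E] [MeasurableSpace E] (μ : Measure E) {K A : Set E} {p : E} {r ρ : ℝ}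
    (hr : 0 < r) (hball : ball p r ⊆ K) (hK : K ⊆ closedBall p ρ) (hρ : 0 ≤ ρ) (hKA : K ⊆ A)
    (hA : Convex ℝ A) (hvol : ∀ c, μ (A \ K) < μ (ball c (r / 2))) :
    A ⊆ closedBall p (2 * (ρ + r)) := by
  intro y hy
  by_contra hfar
  rw [mem_closedBall, dist_eq_norm, not_le] at hfar
  set d := ‖y - p‖ with hd
  have hdpos : 0 < d := by linarith
  set t := (ρ + r) / d with ht
  have htd : t * d = ρ + r := div_mul_cancel₀ _ hdpos.ne'
  have htpos : 0 < t := by positivity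
  have hthalf : t < 1 / 2 := by rw [ht, div_lt_iff₀ hdpos]; linarith
  refine absurd (measure_mono ?_) (not_le.2 (hvol (p + t • (y - p))))
  intro q hq
  rw [mem_ball, dist_eq_norm] at hq
  set w := q - (p + t • (y - p)) with hw
  have hqw : q = p + t • (y - p) + w := by rw [hw]; abel
  refine ⟨?_, fun hqK => ?_⟩
  · have hpw : p + (1 - t)⁻¹ • w ∈ A := by
      refine hKA (hball ?_)
      rw [mem_ball, dist_eq_norm, add_sub_cancel_left, norm_smul, Real.norm_eq_abs,
        abs_of_pos (inv_pos.2 (by linarith)), inv_mul_lt_iff₀ (by linarith)]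
      nlinarith
    have := hA hpw hy (by linarith : 0 ≤ 1 - t) htpos.le (by ring)
    rw [smul_add, smul_smul, mul_inv_cancel₀ (by linarith), one_smul] at this
    convert this using 1
    rw [hqw, smul_sub, sub_smul, one_smul]
    abel
  · have h1 := hK hqK
    rw [mem_closedBall, dist_eq_norm] at h1
    have h2 : ‖t • (y - p)‖ ≤ ‖q - p‖ + ‖w‖ := by
      rw [show t • (y - p) = (q - p) - w by rw [hqw]; abel]
      exact norm_sub_le _ _
    rw [norm_smul, Real.norm_eq_abs, abs_of_pos htpos, ← hd, htd] at h2
    linarith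

theorem norm_setIntegral_le_mul_volume_diff {n : ℕ} {K A : Set (EuclideanSpace ℝ (Fin n))}
    (hK : IsCompact K) (hA : IsCompact A) (hKA : K ⊆ A) (hcent : ∫ x in K, x = 0) {R : ℝ}
    (hR : A ⊆ closedBall 0 R) :
    ‖∫ x in A, x‖ ≤ R * (volume (A \ K)).toReal := by
  have hdiff := setIntegral_sdiff hK.measurableSet
    (ContinuousOn.integrableOn_compact (μ := volume) hA (continuousOn_id' A)) hKA
  rw [hcent, sub_zero] at hdiff
  rw [← hdiff]
  refine norm_setIntegral_le_of_norm_le_const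
    ((measure_mono sdiff_subset).trans_lt hA.measure_lt_top) fun x hx => ?_
  simpa using hR hx.1

theorem norm_secondMoment_zero_le {n : ℕ} {A : Set (EuclideanSpace ℝ (Fin n))} {R : ℝ}
    (hR0 : 0 ≤ R) (hR : A ⊆ closedBall 0 R) :
    ‖secondMoment A 0‖ ≤ R ^ 2 * (volume (closedBall (0 : EuclideanSpace ℝ (Fin n)) R)).toReal := by
  refine (pi_norm_le_iff_of_nonneg (by positivity)).2 fun i =>
    (pi_norm_le_iff_of_nonneg (by positivity)).2 fun k => ?_
  have hfin : volume (closedBall (0 : EuclideanSpace ℝ (Fin n)) R) < ⊤ := measure_closedBall_lt_top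
  refine (norm_setIntegral_le_of_norm_le_const (C := R ^ 2)
    ((measure_mono hR).trans_lt hfin) fun x hx => ?_).trans ?_
  · have hx' : ‖x‖ ≤ R := by simpa using hR hx
    have hi := (PiLp.norm_apply_le x i).trans hx'
    have hk := (PiLp.norm_apply_le x k).trans hx'
    simp only [PiLp.zero_apply, sub_zero, norm_mul, sq]
    gcongr
  · exact mul_le_mul_of_nonneg_left (ENNReal.toReal_mono hfin.ne (measure_mono hR)) (by positivity)

theorem norm_secondMoment_centroid_sub_le {n : ℕ} {A : Set (EuclideanSpace ℝ (Fin n))}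
    (hA : IsCompact A) {v b : ℝ} (hv : 0 < v) (hvA : v ≤ (volume A).toReal)
    (hb : ‖∫ x in A, x‖ ≤ b) :
    ‖secondMoment A (centroid A) - secondMoment A 0‖ ≤ v⁻¹ * b ^ 2 := by
  refine (pi_norm_le_iff_of_nonneg (by positivity)).2 fun i =>
    (pi_norm_le_iff_of_nonneg (by positivity)).2 fun k => ?_
  have hV := hv.trans_le hvA
  have hi := (PiLp.norm_apply_le (∫ x in A, x) i).trans hb
  have hk := (PiLp.norm_apply_le (∫ x in A, x) k).trans hb
  rw [Pi.sub_apply, Pi.sub_apply, secondMoment_centroid hA hV.ne', sub_sub_cancel_left, norm_neg,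
    norm_mul, norm_mul, Real.norm_of_nonneg (inv_nonneg.2 hV.le), sq]
  gcongr
  exact (norm_nonneg _).trans hb

theorem exists_lipschitzOnWith_det_closedBall (n : ℕ) (r : ℝ) : ∃ L,
    LipschitzOnWith L (fun S : Fin n → Fin n → ℝ => Matrix.det (Matrix.of S)) (closedBall 0 r) := by
  have hdet : ContDiff ℝ 1 (fun S : Fin n → Fin n → ℝ => Matrix.det (Matrix.of S)) := by
    simp only [Matrix.det_apply', Matrix.of_apply]
    fun_prop
  exact hdet.contDiffOn.exists_lipschitzOnWith one_ne_zero (convex_closedBall _ _)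
    (isCompact_closedBall _ _)

/-- **Lemma 3, outer case (Meyer–Reisner).** The centered determinant integral of
`K_m = K ∪ C_m` differs from the uncentered one by `O(|K_m \ K|²)`. -/
theorem Mpow2n_union_outer_sets {n : ℕ} (K : Set (EuclideanSpace ℝ (Fin n))) (M : ℝ)
    (hK : IsConvexBody K) (hiso : IsIsotropic K M)
    (C : ℕ → Set (EuclideanSpace ℝ (Fin n)))
    (hmeas : ∀ m, MeasurableSet (C m))
    (hdisj : ∀ m, C m ∩ interior K = ∅)
    (hpos : ∀ m, 0 < volume (C m))
    (hto0 : Tendsto (fun m => volume (C m)) atTop (𝓝 0))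
    (hconv : ∀ m, IsConvexBody (K ∪ C m)) :
    ∃ c > (0 : ℝ), ∃ m₀ : ℕ, ∀ m ≥ m₀,
      |Mpow2n (K ∪ C m) - detInt (K ∪ C m) 0|
        ≤ c * ((volume ((K ∪ C m) \ K)).toReal) ^ 2 := by
  obtain ⟨hKc, -, hKi⟩ := hK
  obtain ⟨p, hp⟩ := hKi
  obtain ⟨r, hr, hball⟩ := Metric.isOpen_iff.1 isOpen_interior p hp
  replace hball := hball.trans interior_subset
  obtain ⟨ρ, hρ, hKρ⟩ : ∃ ρ, 0 ≤ ρ ∧ K ⊆ closedBall p ρ := by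
    obtain ⟨ρ, hρ⟩ := hKc.isBounded.subset_closedBall p
    exact ⟨max ρ 0, le_max_right _ _, hρ.trans (closedBall_subset_closedBall (le_max_left _ _))⟩
  set R := 2 * (ρ + r) + ‖p‖ with hRdef
  have hR0 : 0 < R := by positivity
  set W := (volume (closedBall (0 : EuclideanSpace ℝ (Fin n)) R)).toReal with hW
  have hWfin : volume (closedBall (0 : EuclideanSpace ℝ (Fin n)) R) ≠ ⊤ :=
    measure_closedBall_lt_top.ne
  have hv : 0 < (volume K).toReal :=
    ENNReal.toReal_pos ((measure_ball_pos volume p hr).trans_le (measure_mono hball)).ne'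
      hKc.measure_lt_top.ne
  set v := (volume K).toReal with hvdef
  obtain ⟨L, hL⟩ := exists_lipschitzOnWith_det_closedBall n (R ^ 2 * W + v⁻¹ * (R * W) ^ 2)
  have hsmall : ∀ᶠ m in atTop,
      volume (C m) < volume (ball (0 : EuclideanSpace ℝ (Fin n)) (r / 2)) :=
    hto0.eventually_lt_const (measure_ball_pos volume _ (half_pos hr))
  obtain ⟨m₀, hm₀⟩ := eventually_atTop.1 hsmall
  refine ⟨L * (v⁻¹ * R ^ 2) + 1, by positivity, m₀, fun m hm => ?_⟩
  obtain ⟨hAc, hAconv, -⟩ := hconv m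
  have hKA : K ⊆ K ∪ C m := subset_union_left
  have hAR : K ∪ C m ⊆ closedBall 0 R := by
    refine (hAconv.subset_closedBall_of_volume_diff_lt volume hr hball hKρ hρ hKA
      fun c => ?_).trans (closedBall_subset_closedBall' (by rw [dist_zero_right]))
    rw [Measure.addHaar_ball_center]
    refine (measure_mono ?_).trans_lt (hm₀ m hm)
    rw [union_sdiff_left]
    exact sdiff_subset
  set A := K ∪ C m with hAdef
  set δ := (volume (A \ K)).toReal with hδ
  have hδ0 : 0 ≤ δ := ENNReal.toReal_nonneg
  have hδW : δ ≤ W := ENNReal.toReal_mono hWfin (measure_mono (sdiff_subset.trans hAR))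
  have hvA : v ≤ (volume A).toReal := ENNReal.toReal_mono hAc.measure_lt_top.ne (measure_mono hKA)
  have hsub := norm_secondMoment_centroid_sub_le hAc hv hvA
    (norm_setIntegral_le_mul_volume_diff hKc hAc hKA hiso.2.1 hAR)
  have hzero := norm_secondMoment_zero_le hR0.le hAR
  have hW0 : 0 ≤ W := ENNReal.toReal_nonneg
  have hmono : v⁻¹ * (R * δ) ^ 2 ≤ v⁻¹ * (R * W) ^ 2 := by gcongr
  have hcen : ‖secondMoment A (centroid A)‖ ≤ R ^ 2 * W + v⁻¹ * (R * W) ^ 2 := by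
    have := norm_add_le (secondMoment A 0) (secondMoment A (centroid A) - secondMoment A 0)
    rw [add_sub_cancel] at this
    linarith
  have hlip := hL.norm_sub_le (mem_closedBall_zero_iff.2 hcen)
    (mem_closedBall_zero_iff.2 (hzero.trans (le_add_of_nonneg_right (by positivity))))
  rw [Mpow2n, detInt_eq_det_secondMoment hAc, detInt_eq_det_secondMoment hAc]
  calc _ ≤ L * ‖secondMoment A (centroid A) - secondMoment A 0‖ := hlip
    _ ≤ L * (v⁻¹ * (R * δ) ^ 2) := by gcongr
    _ = L * (v⁻¹ * R ^ 2) * δ ^ 2 := by ring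
    _ ≤ (L * (v⁻¹ * R ^ 2) + 1) * δ ^ 2 := by gcongr; linarith
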